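/- Let δ > 0 and let b0, b1, b2, b3 : {v : 0 < |v| < δ} → ℝ be functions such that for every v in the domain: N(v, b0(v), b1(v), b2(v), b3(v)) = 0 and all three partial derivatives (∂N/∂v), (∂²N/∂v²), (∂³N/∂v³) vanish at (v, b0(v), b1(v), b2(v), b3(v)). Then as v → 0 with v ≠ 0: b0(v) → -12629/3024, b1(v) → 20483/4032, b2(v) → -3937/2016, and b3(v) → 17671/12096, i.e. the coefficients of the method with zero phase-lag and zero first, second and third derivatives of the phase-lag tend to the classical Quinlan–Tremaine coefficients. -/

import Mathlib

/-- Phase-lag numerator of the symmetric 8-step method. -/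
noncomputable def N (v b0 b1 b2 b3 : ℝ) : ℝ :=
  16 * Real.cos v ^ 4 + (8 * b3 * v ^ 2 - 16) * Real.cos v ^ 3
    + (4 * b2 * v ^ 2 - 8) * Real.cos v ^ 2
    + (10 + (2 * b1 - 6 * b3) * v ^ 2) * Real.cos v - 2
    + (b0 - 2 * b2) * v ^ 2

open Filter Topology Asymptotics

/-- Coefficients of `(a + b w + c w²) cos (k w) + (p + q w + r w²) sin (k w)`. -/
structure TrigCoeffs where
  a : ℝ
  b : ℝ
  c : ℝ
  p : ℝ
  q : ℝ
  r : ℝ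

namespace TrigCoeffs

/-- The function of `w` with frequency `k` described by the coefficients. -/
noncomputable def eval (k : ℝ) (t : TrigCoeffs) (w : ℝ) : ℝ :=
  (t.a + t.b * w + t.c * w ^ 2) * Real.cos (k * w)
    + (t.p + t.q * w + t.r * w ^ 2) * Real.sin (k * w)

/-- The coefficients of the derivative. -/
noncomputable def derivative (k : ℝ) (t : TrigCoeffs) : TrigCoeffs where
  a := t.b + k * t.p
  b := 2 * t.c + k * t.q
  c := k * t.r
  p := t.q - k * t.a
  q := 2 * t.r - k * t.b
  r := -(k * t.c)

lemma hasDerivAt_eval (k : ℝ) (t : TrigCoeffs) (w : ℝ) :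
    HasDerivAt (t.eval k) ((t.derivative k).eval k w) w := by
  have hk : HasDerivAt (fun w : ℝ => k * w) k w := by
    simpa using (hasDerivAt_id w).const_mul k
  have hpoly (a b c : ℝ) : HasDerivAt (fun w : ℝ => a + b * w + c * w ^ 2) (b + 2 * c * w) w := by
    have h := (((hasDerivAt_id w).const_mul b).const_add a).add
      (((hasDerivAt_id w).pow 2).const_mul c)
    refine h.congr_deriv ?_
    simp
    ring
  refine (((hpoly t.a t.b t.c).mul hk.cos).add ((hpoly t.p t.q t.r).mul hk.sin)).congr_deriv ?_
  simp only [eval, derivative]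
  ring

/-- The sum over the frequencies `0, …, 4` of the functions described by `s`. -/
noncomputable def sumEval (s : ℕ → TrigCoeffs) (w : ℝ) : ℝ :=
  ∑ k ∈ Finset.range 5, (s k).eval k w

/-- Frequencywise derivative. -/
noncomputable def sumDerivative (s : ℕ → TrigCoeffs) (k : ℕ) : TrigCoeffs := (s k).derivative k

lemma hasDerivAt_sumEval (s : ℕ → TrigCoeffs) (w : ℝ) :
    HasDerivAt (sumEval s) (sumEval (sumDerivative s) w) w := by
  have h := HasDerivAt.fun_sum (u := Finset.range 5)
    (fun k _ => hasDerivAt_eval (k : ℝ) (s k) w)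
  exact h

lemma sumEval_zero (s : ℕ → TrigCoeffs) : sumEval s 0 = ∑ k ∈ Finset.range 5, (s k).a := by
  simp [sumEval, eval]

end TrigCoeffs

lemma isBigO_pow_succ_of_hasDerivAt {f f' : ℝ → ℝ} {n : ℕ}
    (hf : ∀ x, HasDerivAt f (f' x) x) (h0 : f 0 = 0) (hf' : f' =O[𝓝 0] fun x => x ^ n) :
    f =O[𝓝 0] fun x => x ^ (n + 1) := by
  obtain ⟨C, hC⟩ := hf'.bound
  obtain ⟨ε, hε, hball⟩ := Metric.eventually_nhds_iff_ball.1 hC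
  refine IsBigO.of_bound C ?_
  filter_upwards [Metric.ball_mem_nhds (0 : ℝ) hε] with x hx
  have hxε : |x| < ε := by simpa using hx
  have hC0 : 0 ≤ C * |x| ^ n := by
    simpa using (norm_nonneg _).trans (hball x hx)
  have hbound : ∀ y ∈ Metric.closedBall (0 : ℝ) |x|, ‖f' y‖ ≤ C * |x| ^ n := by
    intro y hy
    have hyx : |y| ≤ |x| := by simpa using hy
    have hb := hball y (by simpa using hyx.trans_lt hxε)
    rw [norm_pow, Real.norm_eq_abs y] at hb
    rcases le_or_gt 0 C with hc | hc
    · exact hb.trans (by gcongr)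
    · have hy0 : |y| ^ n = 0 := by
        have := (norm_nonneg _).trans hb
        have := pow_nonneg (abs_nonneg y) n
        nlinarith
      rw [hy0, mul_zero] at hb
      exact hb.trans hC0
  have hmv := (convex_closedBall (0 : ℝ) |x|).norm_image_sub_le_of_norm_hasDerivWithin_le
    (fun y _ => (hf y).hasDerivWithinAt) hbound (x := 0) (y := x) (by simp) (by simp)
  simpa [h0, pow_succ, mul_assoc] using hmv

namespace TrigCoeffs

lemma isBigO_sumEval (n : ℕ) (s : ℕ → TrigCoeffs)
    (h : ∀ j < n, sumEval (sumDerivative^[j] s) 0 = 0) :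
    sumEval s =O[𝓝 0] fun x => x ^ n := by
  induction n generalizing s with
  | zero => simpa using (hasDerivAt_sumEval s 0).continuousAt.isBigO_one ℝ
  | succ n ih =>
    exact isBigO_pow_succ_of_hasDerivAt (hasDerivAt_sumEval s) (h 0 n.succ_pos)
      (ih _ fun j hj => h (j + 1) (Nat.succ_lt_succ hj))

lemma isBigO_sumEval_iterate {n : ℕ} {s : ℕ → TrigCoeffs}
    (h : ∀ j < n, sumEval (sumDerivative^[j] s) 0 = 0) (m i : ℕ) (hmi : m + i = n) :
    sumEval (sumDerivative^[i] s) =O[𝓝[≠] 0] fun x => x ^ m := by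
  refine (isBigO_sumEval m _ fun j hj => ?_).mono nhdsWithin_le_nhds
  rw [← Function.iterate_add_apply]
  exact h _ (by omega)

end TrigCoeffs

/-- The phase-lag numerator with the Quinlan–Tremaine coefficients, frequency by frequency. -/
noncomputable def classicalCoeffs : ℕ → TrigCoeffs
  | 0 => ⟨0, 0, -12629 / 3024, 0, 0, 0⟩
  | 1 => ⟨-2, 0, 20483 / 2016, 0, 0, 0⟩
  | 2 => ⟨4, 0, -3937 / 1008, 0, 0, 0⟩
  | 3 => ⟨-4, 0, 17671 / 6048, 0, 0, 0⟩
  | _ => ⟨2, 0, 0, 0, 0, 0⟩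

lemma sumEval_classicalCoeffs_iterate_zero (j : ℕ) (hj : j < 10) :
    TrigCoeffs.sumEval (TrigCoeffs.sumDerivative^[j] classicalCoeffs) 0 = 0 := by
  rw [TrigCoeffs.sumEval_zero]
  interval_cases j <;>
    norm_num [Finset.sum_range_succ, TrigCoeffs.sumDerivative, TrigCoeffs.derivative,
      classicalCoeffs]

lemma N_eq_classical_add (w b0 b1 b2 b3 : ℝ) :
    N w b0 b1 b2 b3 = TrigCoeffs.sumEval classicalCoeffs w + w ^ 2 *
      ((b0 + 12629 / 3024 - 2 * (b2 + 3937 / 2016))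
        + (2 * (b1 - 20483 / 4032) - 6 * (b3 - 17671 / 12096)) * Real.cos w
        + 4 * (b2 + 3937 / 2016) * Real.cos w ^ 2
        + 8 * (b3 - 17671 / 12096) * Real.cos w ^ 3) := by
  have h4 : Real.cos (4 * w) = 8 * Real.cos w ^ 4 - 8 * Real.cos w ^ 2 + 1 := by
    rw [show 4 * w = 2 * (2 * w) by ring, Real.cos_two_mul, Real.cos_two_mul]
    ring
  simp only [N, TrigCoeffs.sumEval, TrigCoeffs.eval, Finset.sum_range_succ, classicalCoeffs,
    Finset.range_zero, Finset.sum_empty, Nat.cast_ofNat, Nat.cast_zero, Nat.cast_one, one_mul,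
    zero_mul, Real.cos_zero, h4, Real.cos_two_mul, Real.cos_three_mul]
  ring

/-- The first three derivatives of `g + w² P(cos w)` for a cubic polynomial `P`. -/
lemma iteratedDeriv_add_sq_mul_cubic_cos {g g1 g2 g3 : ℝ → ℝ}
    (hg : ∀ w, HasDerivAt g (g1 w) w) (hg1 : ∀ w, HasDerivAt g1 (g2 w) w)
    (hg2 : ∀ w, HasDerivAt g2 (g3 w) w) (a0 a1 a2 a3 v : ℝ)
    {f : ℝ → ℝ} (hf : ∀ w, f w = g w + w ^ 2 *
      (a0 + a1 * Real.cos w + a2 * Real.cos w ^ 2 + a3 * Real.cos w ^ 3))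
    {P0 P1 P2 P3 q1 q2 q3 : ℝ}
    (hP0 : P0 = a0 + a1 * Real.cos v + a2 * Real.cos v ^ 2 + a3 * Real.cos v ^ 3)
    (hP1 : P1 = a1 + 2 * a2 * Real.cos v + 3 * a3 * Real.cos v ^ 2)
    (hP2 : P2 = 2 * a2 + 6 * a3 * Real.cos v) (hP3 : P3 = 6 * a3)
    (hq1 : q1 = -(Real.sin v * P1))
    (hq2 : q2 = Real.sin v ^ 2 * P2 - Real.cos v * P1)
    (hq3 : q3 = -(Real.sin v ^ 3 * P3) + 3 * Real.sin v * Real.cos v * P2 + Real.sin v * P1) :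
    deriv f v = g1 v + 2 * v * P0 + v ^ 2 * q1 ∧
    iteratedDeriv 2 f v = g2 v + 2 * P0 + 4 * v * q1 + v ^ 2 * q2 ∧
    iteratedDeriv 3 f v = g3 v + 6 * q1 + 6 * v * q2 + v ^ 2 * q3 := by
  have hpow (n : ℕ) (w : ℝ) : HasDerivAt (fun w => Real.cos w ^ n)
      (n * Real.cos w ^ (n - 1) * -Real.sin w) w := (Real.hasDerivAt_cos w).fun_pow n
  have hcubic (c0 c1 c2 c3 w : ℝ) : HasDerivAt
      (fun w => c0 + c1 * Real.cos w + c2 * Real.cos w ^ 2 + c3 * Real.cos w ^ 3)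
      (-(Real.sin w * (c1 + 2 * c2 * Real.cos w + 3 * c3 * Real.cos w ^ 2))) w := by
    refine ((((Real.hasDerivAt_cos w).const_mul c1).const_add c0).add
      ((hpow 2 w).const_mul c2)).add ((hpow 3 w).const_mul c3) |>.congr_deriv ?_
    norm_num
    ring
  let p : ℝ → ℝ := fun w => a0 + a1 * Real.cos w + a2 * Real.cos w ^ 2 + a3 * Real.cos w ^ 3
  let p' : ℝ → ℝ := fun w => a1 + 2 * a2 * Real.cos w + 3 * a3 * Real.cos w ^ 2
  let p'' : ℝ → ℝ := fun w => 2 * a2 + 6 * a3 * Real.cos w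
  let r1 : ℝ → ℝ := fun w => -(Real.sin w * p' w)
  let r2 : ℝ → ℝ := fun w => Real.sin w ^ 2 * p'' w - Real.cos w * p' w
  let r3 : ℝ → ℝ := fun w => -(Real.sin w ^ 3 * (6 * a3))
    + 3 * Real.sin w * Real.cos w * p'' w + Real.sin w * p' w
  have hp (w : ℝ) : HasDerivAt p (r1 w) w := hcubic a0 a1 a2 a3 w
  have hp' (w : ℝ) : HasDerivAt p' (-(Real.sin w * p'' w)) w := by
    convert hcubic a1 (2 * a2) (3 * a3) 0 w using 1
    · funext x
      simp only [p']
      ring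
    · simp only [p'']
      ring
  have hp'' (w : ℝ) : HasDerivAt p'' (-(Real.sin w * (6 * a3))) w := by
    convert hcubic (2 * a2) (6 * a3) 0 0 w using 1
    · funext x
      simp only [p'']
      ring
    · ring
  have hr1 (w : ℝ) : HasDerivAt r1 (r2 w) w := by
    refine ((Real.hasDerivAt_sin w).mul (hp' w)).neg.congr_deriv ?_
    simp only [r2]
    ring
  have hr2 (w : ℝ) : HasDerivAt r2 (r3 w) w := by
    refine ((((Real.hasDerivAt_sin w).fun_pow 2).mul (hp'' w)).sub
      ((Real.hasDerivAt_cos w).mul (hp' w))).congr_deriv ?_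
    simp only [r3]
    norm_num
    ring
  have hsq (w : ℝ) : HasDerivAt (fun w : ℝ => w ^ 2) (2 * w) w := by
    simpa using hasDerivAt_pow 2 w
  have hid (w : ℝ) : HasDerivAt (fun w : ℝ => w) 1 w := hasDerivAt_id w
  have hd1 : deriv f = fun w => g1 w + 2 * w * p w + w ^ 2 * r1 w := by
    rw [funext hf]
    funext w
    refine (((hg w).add ((hsq w).mul (hp w))).congr_deriv ?_).deriv
    ring
  have hd2 : iteratedDeriv 2 f = fun w => g2 w + 2 * p w + 4 * w * r1 w + w ^ 2 * r2 w := by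
    rw [iteratedDeriv_succ, iteratedDeriv_one, hd1]
    funext w
    refine ((((hg1 w).add (((hid w).const_mul 2).mul (hp w))).add
      ((hsq w).mul (hr1 w))).congr_deriv ?_).deriv
    ring
  have hd3 : iteratedDeriv 3 f = fun w => g3 w + 6 * r1 w + 6 * w * r2 w + w ^ 2 * r3 w := by
    rw [iteratedDeriv_succ, hd2]
    funext w
    refine (((((hg2 w).add ((hp w).const_mul 2)).add (((hid w).const_mul 4).mul (hr1 w))).add
      ((hsq w).mul (hr2 w))).congr_deriv ?_).deriv
    ring
  rw [hd1, hd2, hd3]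
  subst hP0 hP1 hP2 hP3 hq1 hq2 hq3
  exact ⟨rfl, rfl, rfl⟩

lemma isBigO_of_pow_mul_isBigO {h g : ℝ → ℝ} {m n : ℕ} (hh : (fun x : ℝ => x) =O[𝓝[≠] 0] h)
    (hg : (fun x => h x ^ m * g x) =O[𝓝[≠] 0] fun x => x ^ (n + m)) :
    g =O[𝓝[≠] 0] fun x => x ^ n := by
  have h1 : (fun x => x ^ m * g x) =O[𝓝[≠] 0] fun x => x ^ (n + m) :=
    ((hh.pow m).mul (isBigO_refl g _)).trans hg
  have h2 := (isBigO_refl (fun x : ℝ => (x ^ m)⁻¹) (𝓝[≠] 0)).mul h1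
  refine h2.congr' ?_ ?_ <;> filter_upwards [self_mem_nhdsWithin] with x hx
  · exact inv_mul_cancel_left₀ (pow_ne_zero m hx) _
  · rw [pow_add, mul_comm, mul_assoc, mul_inv_cancel₀ (pow_ne_zero m hx), mul_one]

lemma isBigO_id_sin : (fun x : ℝ => x) =O[𝓝[≠] 0] Real.sin :=
  Real.isEquivalent_sin.symm.isBigO.mono nhdsWithin_le_nhds

/-- If the first four Taylor coefficients at `v` of `g + w² P(cos w)`, `P` a cubic polynomial
depending on `v`, vanish and `g` vanishes to order ten at `0`, then `P` and its derivatives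
at `cos v` are small. -/
lemma isBigO_of_vanishing {g g1 g2 g3 P0 P1 P2 P3 : ℝ → ℝ}
    (hg : g =O[𝓝[≠] 0] fun x => x ^ 10) (hg1 : g1 =O[𝓝[≠] 0] fun x => x ^ 9)
    (hg2 : g2 =O[𝓝[≠] 0] fun x => x ^ 8) (hg3 : g3 =O[𝓝[≠] 0] fun x => x ^ 7)
    {q1 q2 q3 : ℝ → ℝ}
    (hq1 : ∀ v, q1 v = -(Real.sin v * P1 v))
    (hq2 : ∀ v, q2 v = Real.sin v ^ 2 * P2 v - Real.cos v * P1 v)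
    (hq3 : ∀ v, q3 v = -(Real.sin v ^ 3 * P3 v) + 3 * Real.sin v * Real.cos v * P2 v
      + Real.sin v * P1 v)
    (h0 : ∀ᶠ v in 𝓝[≠] 0, g v + v ^ 2 * P0 v = 0)
    (h1 : ∀ᶠ v in 𝓝[≠] 0, g1 v + 2 * v * P0 v + v ^ 2 * q1 v = 0)
    (h2 : ∀ᶠ v in 𝓝[≠] 0, g2 v + 2 * P0 v + 4 * v * q1 v + v ^ 2 * q2 v = 0)
    (h3 : ∀ᶠ v in 𝓝[≠] 0, g3 v + 6 * q1 v + 6 * v * q2 v + v ^ 2 * q3 v = 0) :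
    P0 =O[𝓝[≠] 0] (fun x => x ^ 8) ∧ P1 =O[𝓝[≠] 0] (fun x => x ^ 6) ∧
    P2 =O[𝓝[≠] 0] (fun x => x ^ 4) ∧ P3 =O[𝓝[≠] 0] (fun x => x ^ 2) := by
  have hidO : (fun x : ℝ => x) =O[𝓝[≠] 0] fun x => x := isBigO_refl _ _
  have hcos : Real.cos =O[𝓝[≠] 0] fun _ => (1 : ℝ) :=
    (Real.continuous_cos.continuousAt.isBigO_one ℝ).mono nhdsWithin_le_nhds
  have hsin : Real.sin =O[𝓝[≠] 0] fun x => x :=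
    IsBigO.of_bound 1 (Eventually.of_forall fun x => by simpa using Real.abs_sin_le_abs)
  have hP0 : P0 =O[𝓝[≠] 0] fun x => x ^ 8 := by
    refine isBigO_of_pow_mul_isBigO (m := 2) hidO (hg.neg_left.congr' ?_ .rfl)
    filter_upwards [h0] with v hv
    linarith
  have hQ1 : q1 =O[𝓝[≠] 0] fun x => x ^ 7 := by
    have hvP : (fun v => v * P0 v) =O[𝓝[≠] 0] fun x => x ^ 9 :=
      (hidO.mul hP0).congr_right fun x => by ring
    refine isBigO_of_pow_mul_isBigO (m := 2) hidO
      ((hg1.add (hvP.const_mul_left 2)).neg_left.congr' ?_ .rfl)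
    filter_upwards [h1] with v hv
    linarith
  have hP1 : P1 =O[𝓝[≠] 0] fun x => x ^ 6 := by
    refine isBigO_of_pow_mul_isBigO (m := 1) isBigO_id_sin
      (hQ1.neg_left.congr_left fun v => ?_)
    rw [hq1]
    ring
  have hQ2 : q2 =O[𝓝[≠] 0] fun x => x ^ 6 := by
    have hvq : (fun v => v * q1 v) =O[𝓝[≠] 0] fun x => x ^ 8 :=
      (hidO.mul hQ1).congr_right fun x => by ring
    refine isBigO_of_pow_mul_isBigO (m := 2) hidO
      (((hg2.add (hP0.const_mul_left 2)).add (hvq.const_mul_left 4)).neg_left.congr' ?_ .rfl)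
    filter_upwards [h2] with v hv
    linarith
  have hP2 : P2 =O[𝓝[≠] 0] fun x => x ^ 4 := by
    have hcP : (fun v => Real.cos v * P1 v) =O[𝓝[≠] 0] fun x => x ^ 6 :=
      (hcos.mul hP1).congr_right fun x => by ring
    refine isBigO_of_pow_mul_isBigO (m := 2) isBigO_id_sin
      ((hQ2.add hcP).congr_left fun v => ?_)
    rw [hq2]
    ring
  have hQ3 : q3 =O[𝓝[≠] 0] fun x => x ^ 5 := by
    have hvq : (fun v => v * q2 v) =O[𝓝[≠] 0] fun x => x ^ 7 :=
      (hidO.mul hQ2).congr_right fun x => by ring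
    refine isBigO_of_pow_mul_isBigO (m := 2) hidO
      (((hg3.add (hQ1.const_mul_left 6)).add (hvq.const_mul_left 6)).neg_left.congr' ?_ .rfl)
    filter_upwards [h3] with v hv
    linarith
  have hP3 : P3 =O[𝓝[≠] 0] fun x => x ^ 2 := by
    have hscP : (fun v => Real.sin v * Real.cos v * P2 v) =O[𝓝[≠] 0] fun x => x ^ 5 :=
      ((hsin.mul hcos).mul hP2).congr_right fun x => by ring
    have hq : q1 =O[𝓝[≠] 0] fun x => x ^ 5 :=
      hQ1.trans ((isLittleO_pow_pow (by norm_num)).isBigO.mono nhdsWithin_le_nhds)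
    refine isBigO_of_pow_mul_isBigO (m := 3) isBigO_id_sin
      (((hscP.const_mul_left 3).sub (hQ3.add hq)).congr_left fun v => ?_)
    rw [hq3, hq1]
    ring
  exact ⟨hP0, hP1, hP2, hP3⟩

/-- The coefficients of the method with zero phase-lag and zero first, second
and third derivatives of the phase-lag tend to the classical
Quinlan–Tremaine coefficients as `v → 0`, `v ≠ 0`. -/
theorem coeffs_zero_PL_three_derivs_tendsto_classical
    (δ : ℝ) (hδ : 0 < δ) (b0 b1 b2 b3 : ℝ → ℝ)
    (hcond : ∀ v : ℝ, 0 < |v| → |v| < δ →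
      N v (b0 v) (b1 v) (b2 v) (b3 v) = 0 ∧
      deriv (fun w => N w (b0 v) (b1 v) (b2 v) (b3 v)) v = 0 ∧
      iteratedDeriv 2 (fun w => N w (b0 v) (b1 v) (b2 v) (b3 v)) v = 0 ∧
      iteratedDeriv 3 (fun w => N w (b0 v) (b1 v) (b2 v) (b3 v)) v = 0) :
    Filter.Tendsto b0 (nhdsWithin 0 {(0 : ℝ)}ᶜ) (nhds (-12629 / 3024)) ∧
    Filter.Tendsto b1 (nhdsWithin 0 {(0 : ℝ)}ᶜ) (nhds (20483 / 4032)) ∧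
    Filter.Tendsto b2 (nhdsWithin 0 {(0 : ℝ)}ᶜ) (nhds (-3937 / 2016)) ∧
    Filter.Tendsto b3 (nhdsWithin 0 {(0 : ℝ)}ᶜ) (nhds (17671 / 12096)) := by
  set e0 : ℝ → ℝ := fun v => b0 v + 12629 / 3024 with he0
  set e1 : ℝ → ℝ := fun v => b1 v - 20483 / 4032 with he1
  set e2 : ℝ → ℝ := fun v => b2 v + 3937 / 2016 with he2
  set e3 : ℝ → ℝ := fun v => b3 v - 17671 / 12096 with he3
  let P0 : ℝ → ℝ := fun v => (e0 v - 2 * e2 v) + (2 * e1 v - 6 * e3 v) * Real.cos v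
    + 4 * e2 v * Real.cos v ^ 2 + 8 * e3 v * Real.cos v ^ 3
  let P1 : ℝ → ℝ := fun v => (2 * e1 v - 6 * e3 v) + 2 * (4 * e2 v) * Real.cos v
    + 3 * (8 * e3 v) * Real.cos v ^ 2
  let P2 : ℝ → ℝ := fun v => 2 * (4 * e2 v) + 6 * (8 * e3 v) * Real.cos v
  let P3 : ℝ → ℝ := fun v => 6 * (8 * e3 v)
  let q1 : ℝ → ℝ := fun v => -(Real.sin v * P1 v)
  let q2 : ℝ → ℝ := fun v => Real.sin v ^ 2 * P2 v - Real.cos v * P1 v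
  let q3 : ℝ → ℝ := fun v => -(Real.sin v ^ 3 * P3 v) + 3 * Real.sin v * Real.cos v * P2 v
    + Real.sin v * P1 v
  let g (i : ℕ) : ℝ → ℝ := TrigCoeffs.sumEval (TrigCoeffs.sumDerivative^[i] classicalCoeffs)
  have hg (i : ℕ) (w : ℝ) : HasDerivAt (g i) (g (i + 1) w) w := by
    simp only [g, Function.iterate_succ_apply']
    exact TrigCoeffs.hasDerivAt_sumEval _ w
  have hgO (m i : ℕ) (hmi : m + i = 10) : g i =O[𝓝[≠] 0] fun x => x ^ m :=
    TrigCoeffs.isBigO_sumEval_iterate sumEval_classicalCoeffs_iterate_zero m i hmi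
  have hnear : ∀ᶠ v in 𝓝[≠] (0 : ℝ), 0 < |v| ∧ |v| < δ := by
    filter_upwards [self_mem_nhdsWithin,
      nhdsWithin_le_nhds (Metric.ball_mem_nhds (0 : ℝ) hδ)] with v hv hvδ
    exact ⟨abs_pos.2 hv, by simpa using hvδ⟩
  have hder (v : ℝ) := iteratedDeriv_add_sq_mul_cubic_cos (hg 0) (hg 1) (hg 2)
    (e0 v - 2 * e2 v) (2 * e1 v - 6 * e3 v) (4 * e2 v) (8 * e3 v) v
    (fun w => N_eq_classical_add w (b0 v) (b1 v) (b2 v) (b3 v))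
    (P0 := P0 v) (P1 := P1 v) (P2 := P2 v) (P3 := P3 v) (q1 := q1 v) (q2 := q2 v) (q3 := q3 v)
    rfl rfl rfl rfl rfl rfl rfl
  obtain ⟨hP0, hP1, hP2, hP3⟩ := isBigO_of_vanishing (P0 := P0) (P1 := P1) (P2 := P2) (P3 := P3)
    (hgO 10 0 rfl) (hgO 9 1 rfl) (hgO 8 2 rfl) (hgO 7 3 rfl)
    (q1 := q1) (q2 := q2) (q3 := q3) (fun _ => rfl) (fun _ => rfl) (fun _ => rfl)
    (hnear.mono fun v hv => (N_eq_classical_add v (b0 v) (b1 v) (b2 v) (b3 v)).symm.trans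
      (hcond v hv.1 hv.2).1)
    (hnear.mono fun v hv => (hder v).1.symm.trans (hcond v hv.1 hv.2).2.1)
    (hnear.mono fun v hv => (hder v).2.1.symm.trans (hcond v hv.1 hv.2).2.2.1)
    (hnear.mono fun v hv => (hder v).2.2.symm.trans (hcond v hv.1 hv.2).2.2.2)
  have hlim {h : ℝ → ℝ} {n : ℕ} (hn : n ≠ 0) (hh : h =O[𝓝[≠] 0] fun x => x ^ n) :
      Tendsto h (𝓝[≠] 0) (𝓝 0) := by
    refine hh.trans_tendsto (Tendsto.mono_left ?_ nhdsWithin_le_nhds)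
    simpa [hn] using (continuous_pow (M := ℝ) n).tendsto 0
  have hcos : Tendsto Real.cos (𝓝[≠] 0) (𝓝 1) := by
    simpa using (Real.continuous_cos.tendsto 0).mono_left nhdsWithin_le_nhds
  have te3 : Tendsto e3 (𝓝[≠] 0) (𝓝 0) := by
    have h := (hlim two_ne_zero hP3).const_mul (1 / 48)
    rw [mul_zero] at h
    exact h.congr fun v => by simp only [P3]; ring
  have te2 : Tendsto e2 (𝓝[≠] 0) (𝓝 0) := by
    have h := ((hlim four_ne_zero hP2).sub ((te3.mul hcos).const_mul 48)).const_mul (1 / 8)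
    rw [zero_mul, mul_zero, sub_zero, mul_zero] at h
    exact h.congr fun v => by simp only [P2]; ring
  have te1 : Tendsto e1 (𝓝[≠] 0) (𝓝 0) := by
    have h := ((((hlim (by norm_num) hP1).sub ((te2.mul hcos).const_mul 8)).sub
      ((te3.mul (hcos.pow 2)).const_mul 24)).add (te3.const_mul 6)).const_mul (1 / 2)
    norm_num only at h
    exact h.congr fun v => by simp only [P1]; ring
  have te0 : Tendsto e0 (𝓝[≠] 0) (𝓝 0) := by
    have h := ((((hlim (by norm_num) hP0).sub
      (((te1.const_mul 2).sub (te3.const_mul 6)).mul hcos)).sub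
      ((te2.mul (hcos.pow 2)).const_mul 4)).sub ((te3.mul (hcos.pow 3)).const_mul 8)).add
      (te2.const_mul 2)
    norm_num only at h
    exact h.congr fun v => by simp only [P0]; ring
  refine ⟨?_, ?_, ?_, ?_⟩
  · have h := te0.sub_const (12629 / 3024)
    norm_num [he0] at h ⊢
    exact h
  · have h := te1.add_const (20483 / 4032)
    norm_num [he1] at h ⊢
    exact h
  · have h := te2.sub_const (3937 / 2016)
    norm_num [he2] at h ⊢
    exact h
  · have h := te3.add_const (17671 / 12096)
    norm_num [he3] at h ⊢
    exact h
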